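/- Golomb construction G3(q, φ): Let q > 3 be a prime power, and let φ be a primitive element of the finite field F_q for which 1 − φ is also primitive. Then the (q−3)×(q−3) array (s_{i,j}) given by s_{i,j} = I[φ^{i+1} + (1−φ)^{j+1} = 1] for i, j ∈ {1, 2, …, q−3}, where the equation is over F_q, is an order q−3 Costas array. -/

import Mathlib

/-- An order `n` permutation array: an `n × n` array with entries in `{0,1}`,
indexed by `{1, …, n}`, such that every row and every column contains exactly one `1`. -/
def IsPermArray (n : ℕ) (s : ℕ → ℕ → ℕ) : Prop :=
  (∀ i ∈ Finset.Icc 1 n, ∀ j ∈ Finset.Icc 1 n, s i j = 0 ∨ s i j = 1) ∧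
  (∀ i ∈ Finset.Icc 1 n, ∑ j ∈ Finset.Icc 1 n, s i j = 1) ∧
  (∀ j ∈ Finset.Icc 1 n, ∑ i ∈ Finset.Icc 1 n, s i j = 1)

/-- An order `n` Costas array: a permutation array in which the vectors joining
pairs of `1` entries are all distinct. -/
def IsCostasArray (n : ℕ) (s : ℕ → ℕ → ℕ) : Prop :=
  IsPermArray n s ∧
  ∀ i1 ∈ Finset.Icc 1 n, ∀ j1 ∈ Finset.Icc 1 n,
  ∀ i2 ∈ Finset.Icc 1 n, ∀ j2 ∈ Finset.Icc 1 n,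
  ∀ i3 ∈ Finset.Icc 1 n, ∀ j3 ∈ Finset.Icc 1 n,
  ∀ i4 ∈ Finset.Icc 1 n, ∀ j4 ∈ Finset.Icc 1 n,
    s i1 j1 = 1 → s i2 j2 = 1 → s i3 j3 = 1 → s i4 j4 = 1 →
    ((i2 : ℤ) - (i1 : ℤ), (j2 : ℤ) - (j1 : ℤ)) =
      ((i4 : ℤ) - (i3 : ℤ), (j4 : ℤ) - (j3 : ℤ)) →
    ((i2 : ℤ) - (i1 : ℤ), (j2 : ℤ) - (j1 : ℤ)) ≠ (0, 0) →
    (i1, j1) = (i3, j3)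

/-- A primitive element of a finite field: a generator of its multiplicative group. -/
def IsPrimitiveElt {F : Type*} [Field F] [Fintype F] (φ : F) : Prop :=
  orderOf φ = Fintype.card F - 1

namespace IsPrimitiveElt

variable {F : Type*} [Field F] [Fintype F]

lemma isPrimitiveRoot {φ : F} (hφ : IsPrimitiveElt φ) :
    IsPrimitiveRoot φ (Fintype.card F - 1) :=
  hφ ▸ IsPrimitiveRoot.orderOf φ

lemma exists_pow_eq {φ x : F} (hφ : IsPrimitiveElt φ) (hx : x ≠ 0) :
    ∃ k < Fintype.card F - 1, φ ^ k = x :=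
  have : NeZero (Fintype.card F - 1) :=
    ⟨by have := Fintype.one_lt_card (α := F); omega⟩
  hφ.isPrimitiveRoot.eq_pow_of_pow_eq_one (FiniteField.pow_card_sub_one_eq_one x hx)

lemma pow_succ_inj {φ : F} (hφ : IsPrimitiveElt φ) {i j : ℕ}
    (hi : i ∈ Finset.Icc 1 (Fintype.card F - 3)) (hj : j ∈ Finset.Icc 1 (Fintype.card F - 3))
    (h : φ ^ (i + 1) = φ ^ (j + 1)) : i = j := by
  rw [Finset.mem_Icc] at hi hj
  have := hφ.isPrimitiveRoot.pow_inj (by omega) (by omega) h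
  omega

lemma exists_forall_pow_add_pow_eq_one_iff {φ ψ : F} (hφ : IsPrimitiveElt φ)
    (hψ : IsPrimitiveElt ψ) (hsum : φ + ψ = 1) {i : ℕ}
    (hi : i ∈ Finset.Icc 1 (Fintype.card F - 3)) :
    ∃ j ∈ Finset.Icc 1 (Fintype.card F - 3), ∀ j' ∈ Finset.Icc 1 (Fintype.card F - 3),
      φ ^ (i + 1) + ψ ^ (j' + 1) = 1 ↔ j = j' := by
  have hi' := Finset.mem_Icc.1 hi
  have hroot := hφ.isPrimitiveRoot
  have h1 : φ ^ (i + 1) ≠ 1 := hroot.pow_ne_one_of_pos_of_lt (by omega) (by omega)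
  have h2 : φ ^ (i + 1) ≠ φ := fun h => by
    have := hroot.pow_inj (i := i + 1) (j := 1) (by omega) (by omega) (by simpa using h)
    omega
  have h0 : φ ^ (i + 1) ≠ 0 := pow_ne_zero _ (hroot.ne_zero (by omega))
  obtain ⟨k, hk, hpow⟩ := hψ.exists_pow_eq (sub_ne_zero.2 h1.symm)
  have hk0 : k ≠ 0 := by
    rintro rfl
    exact h0 (by linear_combination hpow)
  have hk1 : k ≠ 1 := by
    rintro rfl
    exact h2 (by linear_combination hpow - hsum)
  obtain ⟨j, rfl⟩ := Nat.exists_eq_add_one_of_ne_zero hk0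
  have hj : j ∈ Finset.Icc 1 (Fintype.card F - 3) := Finset.mem_Icc.2 (by omega)
  refine ⟨j, hj, fun j' hj' => ⟨fun h => hψ.pow_succ_inj hj hj' ?_, ?_⟩⟩
  · linear_combination hpow - h
  · rintro rfl
    linear_combination hpow

end IsPrimitiveElt

/-- Golomb construction `G₃(q, φ)`: for a prime power `q > 3` and a primitive element
`φ` of `𝔽_q` with `1 − φ` also primitive, the array
`s i j = I[φ^(i+1) + (1−φ)^(j+1) = 1]` for `i, j ∈ {1, …, q−3}`
is an order `q − 3` Costas array. -/
theorem golomb_G3 (q : ℕ) (hq : 3 < q) (F : Type*) [Field F] [Fintype F] [DecidableEq F]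
    (hcard : Fintype.card F = q) (φ : F)
    (hφ : IsPrimitiveElt φ) (hφ' : IsPrimitiveElt (1 - φ)) :
    IsCostasArray (q - 3)
      (fun i j => if φ ^ (i + 1) + (1 - φ) ^ (j + 1) = 1 then 1 else 0) := by
  subst hcard
  have hsum : φ + (1 - φ) = 1 := by ring
  refine ⟨⟨fun i _ j _ => ?_, fun i hi => ?_, fun j hj => ?_⟩, ?_⟩
  · by_cases h : φ ^ (i + 1) + (1 - φ) ^ (j + 1) = 1 <;> simp [h]
  · obtain ⟨j, hj, h⟩ := hφ.exists_forall_pow_add_pow_eq_one_iff hφ' hsum hi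
    rw [Finset.sum_congr rfl fun j' hj' => if_congr (h j' hj') rfl rfl,
      Finset.sum_ite_eq, if_pos hj]
  · obtain ⟨i, hi, h⟩ :=
      hφ'.exists_forall_pow_add_pow_eq_one_iff hφ ((add_comm _ _).trans hsum) hj
    rw [Finset.sum_congr rfl fun i' hi' =>
        if_congr ((Eq.congr_left (add_comm _ _)).trans (h i' hi')) rfl rfl,
      Finset.sum_ite_eq, if_pos hi]
  · intro i1 hi1 j1 hj1 i2 hi2 j2 hj2 i3 hi3 j3 hj3 i4 hi4 j4 hj4 h1 h2 h3 h4 heq hne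
    simp only [ite_eq_left_iff, zero_ne_one, imp_false, not_not] at h1 h2 h3 h4
    rw [Prod.mk.injEq] at heq
    have hcol {i j i' j' : ℕ} (hj : j ∈ Finset.Icc 1 (Fintype.card F - 3))
        (hj' : j' ∈ Finset.Icc 1 (Fintype.card F - 3))
        (h : φ ^ (i + 1) + (1 - φ) ^ (j + 1) = 1)
        (h' : φ ^ (i' + 1) + (1 - φ) ^ (j' + 1) = 1)
        (hpow : φ ^ (i + 1) = φ ^ (i' + 1)) : j = j' :=
      hφ'.pow_succ_inj hj hj' (by linear_combination h - h' - hpow)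
    have hφmul : φ ^ (i1 + 1) * φ ^ (i4 + 1) = φ ^ (i2 + 1) * φ ^ (i3 + 1) := by
      rw [← pow_add, ← pow_add]
      congr 1
      omega
    have hψmul : (1 - φ) ^ (j1 + 1) * (1 - φ) ^ (j4 + 1) =
        (1 - φ) ^ (j2 + 1) * (1 - φ) ^ (j3 + 1) := by
      rw [← pow_add, ← pow_add]
      congr 1
      omega
    rw [eq_sub_of_add_eq' h1, eq_sub_of_add_eq' h2, eq_sub_of_add_eq' h3,
      eq_sub_of_add_eq' h4] at hψmul
    have hprod :
        (φ ^ (i1 + 1) - φ ^ (i2 + 1)) * (φ ^ (i1 + 1) - φ ^ (i3 + 1)) = 0 := by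
      linear_combination φ ^ (i1 + 1) * (hφmul - hψmul) - hφmul
    rcases mul_eq_zero.1 hprod with h | h <;> rw [sub_eq_zero] at h
    · have hi := hφ.pow_succ_inj hi1 hi2 h
      have hj := hcol hj1 hj2 h1 h2 h
      exact absurd (by simp [hi, hj]) hne
    · rw [hφ.pow_succ_inj hi1 hi3 h, hcol hj1 hj3 h1 h3 h]
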